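/- arXiv:1506.00084 — 3 statements merged into one kernel-verified Lean document; each statement's English description precedes it below -/
import Mathlib

section
/- Let G be a group acting on an additive abelian group V by additive automorphisms, and equip G × V with the rack operation (g, u) ◃ (h, v) = (h⁻¹ g h, h⁻¹ • u). Let K = {g ∈ G : g • v = v for all v ∈ V} be the kernel of the action and V^G = {v ∈ V : g • v = v for all g ∈ G} the set of invariant vectors. Then: (1) the set of stabilisers of G × V equals (Z(G) ∩ K) × V; (2) the set of totally fixed elements of G × V equals Z(G) × V^G; (3) the set of units of G × V equals (Z(G) ∩ K) × V^G. -/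
/-- For the linear rack G ⋉ V with (g,u) ◃ (h,v) = (h⁻¹gh, h⁻¹ • u):
stabilisers = (Z(G) ∩ ker) × V, totally fixed elements = Z(G) × V^G,
and units = (Z(G) ∩ ker) × V^G. -/
theorem linear_rack_stab_fix_units
    {G V : Type*} [Group G] [AddCommGroup V] [DistribMulAction G V]
    (op : G × V → G × V → G × V)
    (hop : ∀ (g h : G) (u v : V), op (g, u) (h, v) = (h⁻¹ * g * h, h⁻¹ • u)) :
    {p : G × V | ∀ q : G × V, op q p = q} =
      (((Subgroup.center G : Set G) ∩ {g : G | ∀ v : V, g • v = v}) ×ˢ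
        (Set.univ : Set V)) ∧
    {p : G × V | ∀ q : G × V, op p q = p} =
      ((Subgroup.center G : Set G) ×ˢ {v : V | ∀ g : G, g • v = v}) ∧
    {p : G × V | (∀ q : G × V, op q p = q) ∧ (∀ q : G × V, op p q = p)} =
      (((Subgroup.center G : Set G) ∩ {g : G | ∀ v : V, g • v = v}) ×ˢ
        {v : V | ∀ g : G, g • v = v}) := by
  have stab (h : G) (v : V) : (∀ q : G × V, op q (h, v) = q) ↔
      h ∈ Subgroup.center G ∧ ∀ u : V, h • u = u := by
    simp only [Prod.forall, hop, Prod.mk.injEq, mul_assoc, inv_mul_eq_iff_eq_mul,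
      inv_smul_eq_iff, Subgroup.mem_center_iff]
    exact ⟨fun H => ⟨fun g => (H g 0).1, fun u => (H 1 u).2.symm⟩,
      fun H g u => ⟨H.1 g, (H.2 u).symm⟩⟩
  have fixed (g : G) (u : V) : (∀ q : G × V, op (g, u) q = (g, u)) ↔
      g ∈ Subgroup.center G ∧ ∀ h : G, h • u = u := by
    simp only [Prod.forall, hop, Prod.mk.injEq, mul_assoc, inv_mul_eq_iff_eq_mul,
      inv_smul_eq_iff, Subgroup.mem_center_iff]
    exact ⟨fun H => ⟨fun h => (H h 0).1.symm, fun h => (H h 0).2.symm⟩,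
      fun H h _ => ⟨(H.1 h).symm, (H.2 h).symm⟩⟩
  refine ⟨?_, ?_, ?_⟩ <;> ext ⟨g, u⟩ <;>
    simp only [Set.mem_ofPred_eq, Set.mem_prod, Set.mem_inter_iff, SetLike.mem_coe,
      Set.mem_univ, stab, fixed] <;>
    tauto
end

section
/- Let G be a group acting on an additive abelian group V by additive automorphisms, and let α : G × G → V be any function. Define on V × G the operation (u, g) ◃ (v, h) = (h⁻¹ • u + α(g, h), h⁻¹ g h). Then this operation is right self-distributive, i.e., ((u,g) ◃ (v,h)) ◃ (w,k) = ((u,g) ◃ (w,k)) ◃ ((v,h) ◃ (w,k)) for all (u,g), (v,h), (w,k) ∈ V × G, if and only if α satisfies the cocycle condition k⁻¹ • α(g, h) + α(h⁻¹ g h, k) = (k⁻¹ h⁻¹ k) • α(g, k) + α(k⁻¹ g k, k⁻¹ h k) for all g, h, k ∈ G. -/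
/-- The twisted operation (u,g) ◃ (v,h) = (h⁻¹ • u + α(g,h), h⁻¹gh) on
V × G is right self-distributive if and only if α is a cocycle. -/
theorem twisted_linear_rack_iff_cocycle
    {G V : Type*} [Group G] [AddCommGroup V] [DistribMulAction G V]
    (α : G → G → V)
    (op : V × G → V × G → V × G)
    (hop : ∀ (u v : V) (g h : G),
      op (u, g) (v, h) = (h⁻¹ • u + α g h, h⁻¹ * g * h)) :
    (∀ p q r : V × G, op (op p q) r = op (op p r) (op q r)) ↔
      (∀ g h k : G,
        k⁻¹ • α g h + α (h⁻¹ * g * h) k =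
          (k⁻¹ * h⁻¹ * k) • α g k + α (k⁻¹ * g * k) (k⁻¹ * h * k)) := by
  have conj_inv (h k : G) : (k⁻¹ * h * k)⁻¹ = k⁻¹ * h⁻¹ * k := by group
  constructor
  · intro H g h k
    have e := congrArg Prod.fst (H (0, g) (0, h) (0, k))
    simpa only [hop, conj_inv, smul_zero, zero_add] using e
  · rintro H ⟨u, g⟩ ⟨v, h⟩ ⟨w, k⟩
    simp only [hop, conj_inv, smul_add, smul_smul, add_assoc, H g h k]
    refine Prod.ext ?_ ?_
    · simp only [mul_assoc, mul_inv_cancel, mul_one]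
    · group
end

section
/- A map f : ℝ → ℝ is an automorphism of the topological quandle Core(ℝ) — that is, f is a homeomorphism of ℝ satisfying f(2y − x) = 2 f(y) − f(x) for all x, y ∈ ℝ — if and only if there exist a, b ∈ ℝ with a ≠ 0 such that f(t) = a t + b for all t ∈ ℝ. Hence the automorphism group of Core(ℝ) is the affine group of the real line. -/
/-- A continuous map `ℝ → ℝ` preserving the core quandle operation is affine. -/
theorem eq_affine_of_continuous_of_map_core {f : ℝ → ℝ} (hf : Continuous f)
    (hcore : ∀ x y : ℝ, f (2 * y - x) = 2 * f y - f x) (t : ℝ) :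
    f t = (f 1 - f 0) * t + f 0 := by
  have map_add (x y : ℝ) : f (x + y) = f x + f y - f 0 := by
    have h₀ := hcore 0 ((x + y) / 2)
    have hx := hcore x ((x + y) / 2)
    rw [show 2 * ((x + y) / 2) - 0 = x + y by ring] at h₀
    rw [show 2 * ((x + y) / 2) - x = y by ring] at hx
    linarith
  let g : ℝ →+ ℝ :=
    { toFun := fun x ↦ f x - f 0
      map_zero' := sub_self _
      map_add' := fun x y ↦ by rw [map_add]; ring }
  have hg : Continuous g := hf.sub continuous_const
  have h : f (t * 1) - f 0 = t * (f 1 - f 0) := map_real_smul g hg t 1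
  rw [mul_one] at h
  linarith

/-- A map f : ℝ → ℝ is an automorphism of the topological quandle
Core(ℝ) (a homeomorphism with f(2y − x) = 2f(y) − f(x)) iff it is an invertible
affine map f(t) = a t + b with a ≠ 0. -/
theorem core_real_automorphisms_are_affine (f : ℝ → ℝ) :
    (IsHomeomorph f ∧ ∀ x y : ℝ, f (2 * y - x) = 2 * f y - f x) ↔
      ∃ a b : ℝ, a ≠ 0 ∧ ∀ t : ℝ, f t = a * t + b := by
  constructor
  · rintro ⟨hf, hcore⟩
    exact ⟨f 1 - f 0, f 0, sub_ne_zero.mpr (hf.injective.ne one_ne_zero),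
      eq_affine_of_continuous_of_map_core hf.continuous hcore⟩
  · rintro ⟨a, b, ha, hf⟩
    obtain rfl : f = affineHomeomorph a b ha := funext hf
    refine ⟨(affineHomeomorph a b ha).isHomeomorph, fun x y ↦ ?_⟩
    simp only [affineHomeomorph_apply]
    ring
end
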